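/- If β_n = O(n·log n), then E[L(WST^{β_n}(K_n))] = O(n·log n / (β_n + log n)), where K_n is the complete graph on n vertices. -/

import Mathlib

open MeasureTheory Filter Finset

noncomputable section

set_option linter.unusedSectionVars false

namespace WSTPaper

variable {V : Type} [Fintype V] [DecidableEq V]

open scoped Classical in
/-- The edge sets of spanning trees of `G`. -/
def spanningTrees (G : SimpleGraph V) : Finset (Finset (Sym2 V)) :=
  Finset.univ.filter
    (fun T => ↑T ⊆ G.edgeSet ∧ (SimpleGraph.fromEdgeSet (↑T : Set (Sym2 V))).IsTree)

/-- Weight of a spanning tree: product of its edge conductances. -/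
def treeWeight (c : Sym2 V → ℝ) (T : Finset (Sym2 V)) : ℝ := ∏ e ∈ T, c e

/-- Partition function of the weighted spanning tree measure. -/
def partZ (G : SimpleGraph V) (c : Sym2 V → ℝ) : ℝ := ∑ T ∈ spanningTrees G, treeWeight c T

/-- Product of i.i.d. Uniform[0,1] label measures. -/
def labelMeasure (ι : Type) [Fintype ι] : Measure (ι → ℝ) :=
  Measure.pi fun _ => (volume.restrict (Set.Icc (0:ℝ) 1))

/-- `E[L(WST^β(Kₙ))]`: the expected total length `L(T) = Σ_{e ∈ T} U_e` of the weighted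
spanning tree of the complete graph `Kₙ`, where, conditionally on the i.i.d. Uniform[0,1]
labels `U`, the tree `T` is sampled with probability proportional to `∏_{e∈T} exp(-β U_e)`. -/
def expLengthK (n : ℕ) (β : ℝ) : ℝ :=
  ∫ u : Sym2 (Fin n) → ℝ,
    (∑ T ∈ spanningTrees (⊤ : SimpleGraph (Fin n)),
        treeWeight (fun e => Real.exp (-β * u e)) T * (∑ e ∈ T, u e)) /
      partZ (⊤ : SimpleGraph (Fin n)) (fun e => Real.exp (-β * u e))
    ∂(labelMeasure (Sym2 (Fin n)))

instance isProbabilityMeasure_restrict_unit :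
    IsProbabilityMeasure (volume.restrict (Set.Icc (0 : ℝ) 1)) :=
  ⟨by simp⟩

instance isProbabilityMeasure_labelMeasure (ι : Type) [Fintype ι] :
    IsProbabilityMeasure (labelMeasure ι) := by
  unfold labelMeasure; infer_instance

theorem labelMeasure_eq_infinitePi (ι : Type) [Fintype ι] :
    labelMeasure ι = Measure.infinitePi fun _ => volume.restrict (Set.Icc (0 : ℝ) 1) :=
  (Measure.infinitePi_eq_pi (μ := fun _ : ι => volume.restrict (Set.Icc (0 : ℝ) 1))).symm

theorem measurePreserving_labelMeasure {ι κ : Type} [Fintype ι] [Fintype κ] {φ : ι → κ}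
    (hφ : Function.Injective φ) :
    MeasurePreserving (fun (u : κ → ℝ) i => u (φ i)) (labelMeasure κ) (labelMeasure ι) := by
  refine ⟨by fun_prop, ?_⟩
  rw [labelMeasure_eq_infinitePi, labelMeasure_eq_infinitePi]
  exact Measure.map_infinitePi_infinitePi_of_inj hφ

theorem labelMeasure_rows {ι κ E : Type} [Fintype ι] [Fintype κ] [Fintype E]
    {φ : ι → κ → E} (hφ : Function.Injective (Function.uncurry φ)) {B : ι → Set (κ → ℝ)}
    (hB : ∀ i, MeasurableSet (B i)) :
    labelMeasure E {u | ∀ i, (fun k => u (φ i k)) ∈ B i} = ∏ i, labelMeasure κ (B i) := by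
  have hbox : MeasurableSet (Set.univ.pi B) := MeasurableSet.univ_pi hB
  have h1 := measurePreserving_labelMeasure hφ
  have h2 : MeasurePreserving (MeasurableEquiv.curry ι κ ℝ) (labelMeasure (ι × κ))
      (Measure.pi fun _ : ι => labelMeasure κ) := by
    refine ⟨(MeasurableEquiv.curry ι κ ℝ).measurable, ?_⟩
    rw [labelMeasure_eq_infinitePi, labelMeasure_eq_infinitePi,
      ← Measure.infinitePi_eq_pi]
    exact Measure.infinitePi_map_curry (fun _ _ => volume.restrict (Set.Icc (0 : ℝ) 1))
  rw [← Measure.pi_pi, ← (h2.comp h1).measure_preimage hbox.nullMeasurableSet]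
  congr 1
  ext u
  simp [Set.mem_pi, Function.uncurry, MeasurableEquiv.curry]
  rfl

theorem labelMeasure_ae_mem_Icc (ι : Type) [Fintype ι] :
    ∀ᵐ u ∂labelMeasure ι, ∀ i, u i ∈ Set.Icc (0 : ℝ) 1 := by
  rw [ae_all_iff]
  intro i
  have h : ∀ᵐ x ∂volume.restrict (Set.Icc (0 : ℝ) 1), x ∈ Set.Icc (0 : ℝ) 1 :=
    ae_restrict_mem measurableSet_Icc
  exact (measurePreserving_eval (fun _ : ι => volume.restrict (Set.Icc (0 : ℝ) 1))
    i).quasiMeasurePreserving.ae h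

theorem labelMeasure_tie {ι : Type} [Fintype ι] {a b : ι} (hab : a ≠ b) :
    labelMeasure ι {u | u a = u b} = 0 := by
  classical
  let S : Submodule ℝ (ι → ℝ) :=
    LinearMap.ker (LinearMap.proj (R := ℝ) (φ := fun _ : ι => ℝ) a - LinearMap.proj b)
  have hS : (S : Set (ι → ℝ)) = {u | u a = u b} := by
    ext u
    simp [S, sub_eq_zero]
  have hne : S ≠ ⊤ := by
    intro h
    have hmem : (Pi.single a 1 : ι → ℝ) ∈ (S : Set (ι → ℝ)) := by rw [h]; trivial
    rw [hS] at hmem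
    simp [hab.symm] at hmem
  have h0 := Measure.addHaar_submodule (volume : Measure (ι → ℝ)) S hne
  rw [hS] at h0
  have hle : labelMeasure ι ≤ volume := by
    rw [labelMeasure, ← Measure.restrict_pi_pi, ← volume_pi]
    exact Measure.restrict_le_self
  exact le_antisymm ((hle _).trans h0.le) bot_le

theorem labelMeasure_argmin_le {κ : Type} [Fintype κ] (k₀ : κ) :
    labelMeasure κ {u | ∀ k, u k₀ ≤ u k} ≤ (Fintype.card κ : ENNReal)⁻¹ := by
  classical
  let A : κ → Set (κ → ℝ) := fun j => {u | ∀ k, u j ≤ u k}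
  have hA : ∀ j, MeasurableSet (A j) := fun j => by
    simp only [A, Set.ofPred_forall]
    exact MeasurableSet.iInter fun k =>
      measurableSet_le (measurable_pi_apply j) (measurable_pi_apply k)
  have hsymm : ∀ j, labelMeasure κ (A j) = labelMeasure κ (A k₀) := by
    intro j
    rw [← (measurePreserving_labelMeasure
      (Equiv.swap k₀ j).injective).measure_preimage (hA k₀).nullMeasurableSet]
    congr 1
    ext u
    simp only [A, Set.mem_preimage, Set.mem_ofPred_eq, Equiv.swap_apply_left]
    exact ((Equiv.swap k₀ j).forall_congr_left (p := fun k => u j ≤ u k)).trans (by simp)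
  have hdisj : Pairwise (Function.onFun (AEDisjoint (labelMeasure κ)) A) := by
    intro i j hij
    refine measure_mono_null ?_ (labelMeasure_tie hij)
    rintro u ⟨hi, hj⟩
    exact le_antisymm (hi j) (hj i)
  have hsum : ∑ j, labelMeasure κ (A j) ≤ 1 := by
    rw [← tsum_fintype (L := .unconditional _),
      ← measure_iUnion₀ hdisj fun j => (hA j).nullMeasurableSet]
    exact prob_le_one
  simp only [hsymm, sum_const, card_univ, nsmul_eq_mul] at hsum
  rw [ENNReal.le_inv_iff_mul_le, mul_comm]
  exact hsum

theorem integral_inf'_le {E : Type} [Fintype E] {κ : Type} {D : Finset κ}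
    (hD : D.Nonempty) {φ : κ → E} (hφ : Function.Injective φ) :
    ∫ u, D.inf' hD (fun k => u (φ k)) ∂labelMeasure E ≤ (D.card : ℝ)⁻¹ ∧
      Integrable (fun u => D.inf' hD (fun k => u (φ k))) (labelMeasure E) := by
  have hmeas : Measurable fun u : E → ℝ => D.inf' hD (fun k => u (φ k)) :=
    (Continuous.finset_inf'_apply hD fun k _ => continuous_apply (φ k)).measurable
  have hmem : ∀ᵐ u ∂labelMeasure E, D.inf' hD (fun k => u (φ k)) ∈ Set.Icc (0 : ℝ) 1 := by
    filter_upwards [labelMeasure_ae_mem_Icc E] with u hu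
    obtain ⟨k, hk⟩ := id hD
    exact ⟨(Finset.le_inf'_iff _ _).2 fun k _ => (hu _).1, (Finset.inf'_le _ hk).trans (hu _).2⟩
  have hint : Integrable (fun u => D.inf' hD (fun k => u (φ k))) (labelMeasure E) :=
    Integrable.of_mem_Icc 0 1 hmeas.aemeasurable hmem
  refine ⟨?_, hint⟩
  rw [hint.integral_eq_integral_meas_lt (hmem.mono fun u hu => hu.1)]
  have hc : (0 : ℝ) < D.card := by exact_mod_cast hD.card_pos
  have hexp : ∫ t in Set.Ioi (0 : ℝ), Real.exp (-(D.card : ℝ) * t) = (D.card : ℝ)⁻¹ := by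
    rw [integral_exp_mul_Ioi (by simpa using hc)]
    simp
  rw [← hexp]
  refine integral_mono_of_nonneg (.of_forall fun t => measureReal_nonneg)
    (integrableOn_exp_mul_Ioi (by simpa using hc) 0) ?_
  filter_upwards [ae_restrict_mem measurableSet_Ioi] with t ht
  have hrow := labelMeasure_rows (E := E) (ι := D) (κ := Unit) (φ := fun k _ => φ k)
    (fun x y h => by
      have := hφ h
      ext; simp_all) (B := fun _ => {x | t < x ()})
    (fun _ => measurableSet_lt measurable_const (measurable_pi_apply _))
  have hset : {u : E → ℝ | t < D.inf' hD (fun k => u (φ k))} =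
      {u | ∀ k : D, (fun _ : Unit => u (φ k)) ∈ {x : Unit → ℝ | t < x ()}} := by
    ext u
    simp [Finset.lt_inf'_iff]
  have hone : labelMeasure Unit {x | t < x ()} ≤ ENNReal.ofReal (Real.exp (-t)) := by
    have := (measurePreserving_eval (fun _ : Unit => volume.restrict (Set.Icc (0 : ℝ) 1))
      ()).measure_preimage (measurableSet_Ioi (a := t)).nullMeasurableSet
    change labelMeasure Unit ((Function.eval ()) ⁻¹' Set.Ioi t) ≤ _
    rw [labelMeasure, this, Measure.restrict_apply measurableSet_Ioi]
    refine (measure_mono (t := Set.Icc t 1) fun x hx => ⟨hx.1.le, hx.2.2⟩).trans ?_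
    rw [Real.volume_Icc]
    exact ENNReal.ofReal_le_ofReal (by linarith [Real.add_one_le_exp (-t)])
  simp only [measureReal_def, hset, hrow, prod_const, card_univ, Fintype.card_coe]
  refine (ENNReal.toReal_mono (by finiteness) (pow_le_pow_left' hone _)).trans ?_
  rw [ENNReal.toReal_pow, ENNReal.toReal_ofReal (Real.exp_pos _).le, ← Real.exp_nat_mul]
  simp

theorem gibbs_mean_le {ι : Type*} {S : Finset ι} (L : ι → ℝ) {t₀ : ι} (ht₀ : t₀ ∈ S) {β : ℝ}
    (hβ : 0 < β) :
    (∑ t ∈ S, Real.exp (-β * L t) * L t) / ∑ t ∈ S, Real.exp (-β * L t) ≤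
      L t₀ + (Real.log S.card + 1) / β := by
  have hcard : (0 : ℝ) < S.card := by exact_mod_cast Finset.card_pos.2 ⟨t₀, ht₀⟩
  have hZ : 0 < ∑ t ∈ S, Real.exp (-β * L t) :=
    Finset.sum_pos (fun t _ => Real.exp_pos _) ⟨t₀, ht₀⟩
  have hmin : Real.exp (-β * L t₀) ≤ ∑ t ∈ S, Real.exp (-β * L t) :=
    Finset.single_le_sum (f := fun t => Real.exp (-β * L t)) (fun t _ => (Real.exp_pos _).le) ht₀
  rw [div_le_iff₀ hZ]
  have key : ∀ t, Real.exp (-β * L t) * L t ≤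
      Real.exp (-β * L t) * (L t₀ + Real.log S.card / β) +
        Real.exp (-β * L t₀) / (S.card * β) := by
    intro t
    have h1 := Real.add_one_le_exp (β * (L t - L t₀) - Real.log S.card)
    have h2 : Real.exp (β * (L t - L t₀) - Real.log S.card) =
        Real.exp (-β * L t₀) / (Real.exp (-β * L t) * S.card) := by
      rw [Real.exp_sub, Real.exp_log hcard, div_eq_div_iff hcard.ne' (by positivity), ← mul_assoc,
        ← Real.exp_add]
      congr 2
      ring
    rw [h2, le_div_iff₀ (by positivity)] at h1
    have h3 : Real.exp (-β * L t) * (L t - L t₀ - Real.log S.card / β) ≤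
        Real.exp (-β * L t₀) / (S.card * β) := by
      rw [le_div_iff₀ (by positivity)]
      calc _ = (β * (L t - L t₀) - Real.log S.card) * (Real.exp (-β * L t) * S.card) := by
            field_simp
        _ ≤ _ := le_trans (by gcongr; linarith) h1
    linarith
  calc _ ≤ ∑ t ∈ S, (Real.exp (-β * L t) * (L t₀ + Real.log S.card / β) +
        Real.exp (-β * L t₀) / (S.card * β)) := Finset.sum_le_sum fun t _ => key t
    _ = (L t₀ + Real.log S.card / β) * (∑ t ∈ S, Real.exp (-β * L t)) +
        Real.exp (-β * L t₀) / β := by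
      rw [Finset.sum_add_distrib, ← Finset.sum_mul, Finset.sum_const, nsmul_eq_mul]
      field_simp
    _ ≤ (L t₀ + Real.log S.card / β) * (∑ t ∈ S, Real.exp (-β * L t)) +
        (∑ t ∈ S, Real.exp (-β * L t)) / β := by gcongr
    _ = _ := by ring

theorem treeWeight_exp (β : ℝ) (u : Sym2 V → ℝ) (T : Finset (Sym2 V)) :
    treeWeight (fun e => Real.exp (-β * u e)) T = Real.exp (-β * ∑ e ∈ T, u e) := by
  rw [treeWeight, ← Real.exp_sum, Finset.mul_sum]

theorem card_of_mem_spanningTrees {G : SimpleGraph V} {T : Finset (Sym2 V)}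
    (hT : T ∈ spanningTrees G) : T.card + 1 = Fintype.card V := by
  classical
  obtain ⟨hsub, htree⟩ := (Finset.mem_filter.1 hT).2
  rw [← htree.card_edgeFinset]
  congr 2
  ext e
  simp only [SimpleGraph.mem_edgeFinset, SimpleGraph.edgeSet_fromEdgeSet, Set.mem_sdiff,
    Finset.mem_coe]
  exact ⟨fun h => ⟨h, G.not_isDiag_of_mem_edgeSet (hsub h)⟩, fun h => h.1⟩

theorem card_spanningTrees_le {n : ℕ} (hn : 1 ≤ n) :
    (spanningTrees (⊤ : SimpleGraph (Fin n))).card ≤ n ^ (2 * n) := by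
  have hsub : spanningTrees (⊤ : SimpleGraph (Fin n)) ⊆
      Finset.powersetCard (n - 1) (Finset.univ : Finset (Sym2 (Fin n))) := by
    intro T hT
    have := card_of_mem_spanningTrees hT
    simp only [Fintype.card_fin] at this
    exact Finset.mem_powersetCard.2 ⟨Finset.subset_univ _, by omega⟩
  have hN : Fintype.card (Sym2 (Fin n)) ≤ n ^ 2 := by
    rw [Sym2.card, Fintype.card_fin, Nat.choose_two_right]
    refine Nat.div_le_of_le_mul ?_
    simp only [Nat.add_sub_cancel]
    nlinarith
  calc _ ≤ _ := Finset.card_le_card hsub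
    _ = (Fintype.card (Sym2 (Fin n))).choose (n - 1) := by simp
    _ ≤ (Fintype.card (Sym2 (Fin n))) ^ (n - 1) := Nat.choose_le_pow _ _
    _ ≤ (n ^ 2) ^ (n - 1) := Nat.pow_le_pow_left hN _
    _ ≤ (n ^ 2) ^ n := Nat.pow_le_pow_right (by positivity) (by omega)
    _ = _ := by rw [pow_mul]

theorem exists_spanningTree_of_reps {n : ℕ} [NeZero n] {u : Sym2 (Fin n) → ℝ}
    (hu : ∀ e, 0 ≤ u e) {f : Fin n → Fin n} (hf : ∀ i, f i ≠ i) {δ : ℝ} {R : Finset (Fin n)}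
    (hR : ∀ x, ∃ k, f^[k] x ∈ R)
    (hub : ∀ v, v ≠ 0 → ∃ w, w ≠ v ∧ w ≠ 0 ∧ u s(v, w) ≤ δ ∧ u s(w, 0) ≤ δ) :
    ∃ T ∈ spanningTrees (⊤ : SimpleGraph (Fin n)),
      ∑ e ∈ T, u e ≤ ∑ i, u s(i, f i) + 2 * δ * R.card := by
  classical
  choose! w hwv hw0 hδ1 hδ2 using hub
  have hle : ∀ v : Fin n, v ≠ 0 → 0 ≤ δ := fun v hv => (hu _).trans (hδ1 v hv)
  let R' := R.filter (· ≠ 0)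
  let E : Finset (Sym2 (Fin n)) := univ.image (fun i => s(i, f i)) ∪
    (R'.image (fun v => s(v, w v)) ∪ R'.image (fun v => s(w v, 0)))
  let H := SimpleGraph.fromEdgeSet (E : Set (Sym2 (Fin n)))
  have hstep : ∀ i, H.Adj i (f i) := fun i => by
    rw [SimpleGraph.fromEdgeSet_adj]
    refine ⟨?_, (hf i).symm⟩
    simp only [E, Finset.coe_union, Finset.coe_image]
    exact Or.inl ⟨i, by simp⟩
  have hiter : ∀ k i, H.Reachable i (f^[k] i) := by
    intro k
    induction k with
    | zero => intro i; exact .rfl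
    | succ k ih => intro i; exact (hstep i).reachable.trans (ih (f i))
  have hrep : ∀ v ∈ R, H.Reachable v 0 := by
    intro v hv
    by_cases h0 : v = 0
    · rw [h0]
    have hv' : v ∈ R' := Finset.mem_filter.2 ⟨hv, h0⟩
    have h1 : H.Adj v (w v) := by
      rw [SimpleGraph.fromEdgeSet_adj]
      refine ⟨?_, (hwv v h0).symm⟩
      simp only [E, Finset.coe_union, Finset.coe_image]
      exact Or.inr (Or.inl ⟨v, hv', rfl⟩)
    have h2 : H.Adj (w v) 0 := by
      rw [SimpleGraph.fromEdgeSet_adj]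
      refine ⟨?_, hw0 v h0⟩
      simp only [E, Finset.coe_union, Finset.coe_image]
      exact Or.inr (Or.inr ⟨v, hv', rfl⟩)
    exact h1.reachable.trans h2.reachable
  have hzero : ∀ v, H.Reachable v 0 := fun v => by
    obtain ⟨k, hk⟩ := hR v
    exact (hiter k v).trans (hrep _ hk)
  have hconn : H.Connected :=
    { preconnected := fun a b => (hzero a).trans (hzero b).symm
      nonempty := ⟨0⟩ }
  obtain ⟨T, hTH, hT⟩ := hconn.exists_isTree_le
  refine ⟨T.edgeFinset, ?_, ?_⟩
  · refine Finset.mem_filter.2 ⟨Finset.mem_univ _, ?_, ?_⟩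
    · rw [SimpleGraph.coe_edgeFinset]
      exact SimpleGraph.edgeSet_mono le_top
    · rw [SimpleGraph.coe_edgeFinset, SimpleGraph.fromEdgeSet_edgeSet]
      exact hT
  have hTE : T.edgeFinset ⊆ E := by
    intro e he
    have he' : e ∈ H.edgeSet := SimpleGraph.edgeSet_mono hTH (SimpleGraph.mem_edgeFinset.1 he)
    rw [SimpleGraph.edgeSet_fromEdgeSet] at he'
    exact he'.1
  have himg : ∀ (S : Finset (Fin n)) (g : Fin n → Sym2 (Fin n)),
      ∑ e ∈ S.image g, u e ≤ ∑ i ∈ S, u (g i) := fun S g =>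
    Finset.sum_image_le_of_nonneg (fun e _ => hu e)
  have hunion : ∀ A B : Finset (Sym2 (Fin n)), ∑ e ∈ A ∪ B, u e ≤ ∑ e ∈ A, u e + ∑ e ∈ B, u e := by
    intro A B
    rw [← Finset.sum_union_inter]
    exact le_add_of_nonneg_right (Finset.sum_nonneg fun e _ => hu e)
  have hδR : ∀ g : Fin n → Sym2 (Fin n), (∀ v ≠ 0, u (g v) ≤ δ) →
      ∑ v ∈ R', u (g v) ≤ δ * R'.card := by
    intro g hg
    refine (Finset.sum_le_card_nsmul R' _ δ fun v hv => hg v (Finset.mem_filter.1 hv).2).trans ?_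
    rw [nsmul_eq_mul, mul_comm]
  have hRR : δ * (R'.card : ℝ) ≤ δ * R.card := by
    rcases R'.eq_empty_or_nonempty with h | ⟨v, hv⟩
    · by_cases hR1 : 0 ≤ δ
      · rw [h]; simp; positivity
      · have : ∀ v : Fin n, v = 0 := fun v => by
          by_contra h0
          exact hR1 (hle v h0)
        exact absurd ((this (f 0)).trans (this 0).symm) (hf 0)
    · have := hle v (Finset.mem_filter.1 hv).2
      gcongr
      exact Finset.filter_subset _ _
  calc ∑ e ∈ T.edgeFinset, u e ≤ ∑ e ∈ E, u e :=
        Finset.sum_le_sum_of_subset_of_nonneg hTE fun e _ _ => hu e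
    _ ≤ ∑ i, u s(i, f i) + (δ * R'.card + δ * R'.card) :=
        (hunion _ _).trans (add_le_add (himg _ _) ((hunion _ _).trans
          (add_le_add ((himg _ _).trans (hδR _ hδ1)) ((himg _ _).trans (hδR _ hδ2)))))
    _ ≤ _ := by linarith

open scoped Classical in
/-- The least points of the cycles of `f`. -/
def cycleReps {n : ℕ} (f : Fin n → Fin n) : Finset (Fin n) :=
  {x | x ∈ Function.periodicPts f ∧ ∀ k, x ≤ f^[k] x}

theorem mem_cycleReps {n : ℕ} {f : Fin n → Fin n} {x : Fin n} :
    x ∈ cycleReps f ↔ x ∈ Function.periodicPts f ∧ ∀ k, x ≤ f^[k] x := by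
  simp [cycleReps]

theorem exists_iterate_mem_cycleReps {n : ℕ} (f : Fin n → Fin n) (x : Fin n) :
    ∃ k, f^[k] x ∈ cycleReps f := by
  obtain ⟨a, b, hab, heq⟩ :=
    Finite.exists_ne_map_eq_of_infinite (fun k : ℕ => f^[k] x)
  wlog hlt : a < b generalizing a b
  · exact this b a hab.symm heq.symm (lt_of_le_of_ne (not_lt.1 hlt) hab.symm)
  obtain ⟨_, ⟨k, rfl⟩, hk⟩ := wellFounded_lt.has_min
    (Set.range fun k : ℕ => f^[k] (f^[a] x)) ⟨_, 0, rfl⟩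
  have hper : Function.IsPeriodicPt f (b - a) (f^[a] x) := by
    change f^[b - a] (f^[a] x) = f^[a] x
    rw [← Function.iterate_add_apply, Nat.sub_add_cancel hlt.le]
    exact heq.symm
  refine ⟨k + a, ?_⟩
  rw [Function.iterate_add_apply]
  refine mem_cycleReps.2 ⟨?_, fun j => ?_⟩
  · exact Function.mk_mem_periodicPts (Nat.sub_pos_of_lt hlt) (hper.apply_iterate k)
  · rw [← Function.iterate_add_apply f j]
    exact not_lt.1 (hk _ ⟨j + k, rfl⟩)

theorem minimalPeriod_le_card {n : ℕ} (f : Fin n → Fin n) (x : Fin n) :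
    Function.minimalPeriod f x ≤ n := by
  have h := Finset.card_le_card_of_injOn (s := Finset.range (Function.minimalPeriod f x))
    (t := (Finset.univ : Finset (Fin n))) (fun k => f^[k] x) (fun _ _ => Finset.mem_univ _)
    (by
      intro i hi j hj hij
      simp only [Finset.coe_range, Set.mem_Iio] at hi hj
      exact (Function.iterate_eq_iterate_iff_of_lt_minimalPeriod hi hj).1 hij)
  simpa using h

theorem succ_mul_card_cycleReps_le {n : ℕ} (f : Fin n → Fin n) (k : ℕ) :
    (k + 1) * (#{x ∈ cycleReps f | Function.minimalPeriod f x = k + 1}) ≤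
      #{x | Function.minimalPeriod f x = k + 1} := by
  rw [mul_comm, ← Finset.card_range (k + 1), ← Finset.card_product]
  refine Finset.card_le_card_of_injOn (fun p => f^[p.2] p.1) ?_ ?_
  · rintro ⟨x, j⟩ h
    simp only [mem_cycleReps, Finset.coe_product, Set.mem_prod, Finset.mem_coe, Finset.mem_filter,
      Finset.mem_univ, true_and, Finset.card_range] at h ⊢
    rw [Function.minimalPeriod_apply_iterate h.1.1.1, h.1.2]
  · rintro ⟨x, i⟩ hx ⟨y, j⟩ hy hxy
    simp only [mem_cycleReps, Finset.coe_product, Set.mem_prod, Finset.mem_coe, Finset.mem_filter,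
      Finset.mem_range, Finset.card_range] at hx hy hxy
    have aux : ∀ {x y : Fin n} {i j : ℕ}, (∀ k, x ≤ f^[k] x) → Function.minimalPeriod f y = k + 1 →
        j < k + 1 → f^[i] x = f^[j] y → x ≤ y := by
      intro x y i j hx hy hj h
      have h1 := hx (k + 1 - j + i)
      rwa [Function.iterate_add_apply, h, ← Function.iterate_add_apply,
        Nat.sub_add_cancel hj.le, ← hy, Function.iterate_minimalPeriod] at h1
    obtain rfl : x = y :=
      le_antisymm (aux hx.1.1.2 hy.1.2 hy.2 hxy) (aux hy.1.1.2 hx.1.2 hx.2 hxy.symm)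
    have := (Function.iterate_eq_iterate_iff_of_lt_minimalPeriod
      (hx.1.2 ▸ hx.2) (hx.1.2 ▸ hy.2)).1 hxy
    rw [this]

theorem card_cycleReps_le {n : ℕ} (f : Fin n → Fin n) :
    ((cycleReps f).card : ℝ) ≤
      ∑ k ∈ Finset.range n, (1 / ((k : ℝ) + 1)) * #{x | Function.minimalPeriod f x = k + 1} := by
  have h : (cycleReps f).card =
      ∑ k ∈ Finset.range n, #{x ∈ cycleReps f | Function.minimalPeriod f x = k + 1} := by
    rw [Finset.card_eq_sum_card_fiberwise (f := fun x => Function.minimalPeriod f x - 1)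
      (t := Finset.range n)]
    · refine Finset.sum_congr rfl fun k _ => ?_
      congr 1
      refine Finset.filter_congr fun x hx => ?_
      have := Function.minimalPeriod_pos_of_mem_periodicPts (mem_cycleReps.1 hx).1
      omega
    · intro x hx
      have := Function.minimalPeriod_pos_of_mem_periodicPts (mem_cycleReps.1 hx).1
      have := minimalPeriod_le_card f x
      simp only [Finset.coe_range, Set.mem_Iio]
      omega
  rw [h, Nat.cast_sum]
  refine Finset.sum_le_sum fun k _ => ?_
  rw [one_div, ← div_eq_inv_mul, le_div_iff₀ (by positivity), mul_comm]
  exact_mod_cast succ_mul_card_cycleReps_le f k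

/-- The shifts `1, …, ⌊(n - 1) / 2⌋`: for each edge of `Kₙ` at most one endpoint is carried to the
other one by such a shift. -/
def shifts (n : ℕ) : Finset (Fin n) := {a | 1 ≤ a.val ∧ a.val ≤ (n - 1) / 2}

theorem card_shifts (n : ℕ) : (shifts n).card = (n - 1) / 2 := by
  have h : (shifts n).map Fin.valEmbedding = Finset.Icc 1 ((n - 1) / 2) := by
    ext a
    simp only [shifts, Finset.mem_map, Finset.mem_filter, Finset.mem_univ, true_and,
      Fin.valEmbedding_apply, Finset.mem_Icc]
    exact ⟨fun ⟨b, hb, h⟩ => h ▸ hb, fun h => ⟨⟨a, by omega⟩, h, rfl⟩⟩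
  rw [← Finset.card_map, h]
  simp

theorem add_ne_zero_of_mem_shifts {n : ℕ} [NeZero n] {a b : Fin n} (ha : a ∈ shifts n)
    (hb : b ∈ shifts n) : a + b ≠ 0 := by
  intro h
  simp only [shifts, Finset.mem_filter, Finset.mem_univ, true_and] at ha hb
  have h1 := congrArg Fin.val h
  rw [Fin.val_add, Nat.mod_eq_of_lt (by omega)] at h1
  have h0 : ((0 : Fin n) : ℕ) = 0 := by simp
  omega

theorem ne_zero_of_mem_shifts {n : ℕ} [NeZero n] {a : Fin n} (ha : a ∈ shifts n) : a ≠ 0 := by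
  rintro rfl
  simp [shifts] at ha

theorem shift_edge_injective {n : ℕ} [NeZero n] {i j a b : Fin n} (ha : a ∈ shifts n)
    (hb : b ∈ shifts n) (h : s(i, i + a) = s(j, j + b)) : i = j ∧ a = b := by
  rcases Sym2.eq_iff.1 h with ⟨rfl, h⟩ | ⟨h1, h2⟩
  · exact ⟨rfl, add_left_cancel h⟩
  · refine absurd ?_ (add_ne_zero_of_mem_shifts hb ha)
    rw [h1, add_assoc] at h2
    exact add_eq_left.1 h2

/-- Injective cyclic sequences of length `k + 1` all of whose increments are in `shifts n`. -/
def shiftCycles (n k : ℕ) [NeZero n] : Finset (Fin (k + 1) → Fin n) :=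
  {v | Function.Injective v ∧ ∀ j, v (j + 1) - v j ∈ shifts n}

theorem card_shiftCycles_le (n k : ℕ) [NeZero n] :
    (shiftCycles n k).card ≤ n * (shifts n).card ^ k := by
  have h : (shiftCycles n k).card ≤
      ((Finset.univ : Finset (Fin n)) ×ˢ Fintype.piFinset fun _ : Fin k => shifts n).card := by
    refine Finset.card_le_card_of_injOn
      (fun v => (v 0, fun j => v j.succ - v j.castSucc)) ?_ ?_
    · intro v hv
      have := (Finset.mem_filter.1 hv).2.2
      simp only [Finset.coe_product, Finset.coe_univ, Set.mem_prod, Set.mem_univ, true_and,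
        Finset.mem_coe, Fintype.mem_piFinset]
      intro j
      rw [← Fin.coeSucc_eq_succ]
      exact this _
    · intro v _ w _ hvw
      simp only [Prod.mk.injEq] at hvw
      funext j
      induction j using Fin.induction with
      | zero => exact hvw.1
      | succ j ih =>
        have := congrFun hvw.2 j
        simp only [ih] at this
        exact sub_left_injective this
  simpa using h

theorem card_minimalPeriod_le {n : ℕ} [NeZero n] {f : Fin n → Fin n}
    (hf : ∀ i, f i - i ∈ shifts n) (k : ℕ) :
    #{x | Function.minimalPeriod f x = k + 1} ≤
      #{v ∈ shiftCycles n k | ∀ j, f (v j) = v (j + 1)} := by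
  refine Finset.card_le_card_of_injOn (fun x (j : Fin (k + 1)) => f^[j.val] x) ?_ ?_
  · intro x hx
    simp only [Finset.coe_filter, Finset.mem_univ, true_and, Set.mem_ofPred_eq] at hx
    have hmod : ∀ i, f^[i % (k + 1)] x = f^[i] x := fun i => by
      rw [← hx, Function.iterate_mod_minimalPeriod_eq]
    have hstep : ∀ j : Fin (k + 1), f (f^[j.val] x) = f^[(j + 1).val] x := by
      intro j
      rw [← Function.iterate_succ_apply' f, Fin.val_add, Fin.coe_ofNat_eq_mod, Nat.add_mod_mod,
        hmod]
    refine Finset.mem_coe.2 (Finset.mem_filter.2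
      ⟨Finset.mem_filter.2 ⟨Finset.mem_univ _, ?_, ?_⟩, hstep⟩)
    · intro i j hij
      exact Fin.ext ((Function.iterate_eq_iterate_iff_of_lt_minimalPeriod
        (i.2.trans_eq hx.symm) (j.2.trans_eq hx.symm)).1 hij)
    · intro j
      change f^[(j + 1).val] x - f^[j.val] x ∈ shifts n
      rw [← hstep]
      exact hf _
  · intro x _ y _ hxy
    exact congrFun hxy 0

/-- The labellings under which some vertex `v ≠ 0` is not joined to `0` by a path of two edges of
length at most `δ`. -/
def hubless (n : ℕ) [NeZero n] (δ : ℝ) : Set (Sym2 (Fin n) → ℝ) :=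
  ⋃ v ∈ {v : Fin n | v ≠ 0}, {u | ∀ w : {w : Fin n // w ≠ v ∧ w ≠ 0},
    ¬(u s(v, w) ≤ δ ∧ u s((w : Fin n), 0) ≤ δ)}

theorem measurableSet_hubless (n : ℕ) [NeZero n] (δ : ℝ) : MeasurableSet (hubless n δ) := by
  refine MeasurableSet.biUnion (Set.to_countable _) fun v _ => ?_
  simp only [Set.ofPred_forall]
  exact MeasurableSet.iInter fun w => MeasurableSet.compl
    ((measurableSet_le (measurable_pi_apply _) measurable_const).inter
      (measurableSet_le (measurable_pi_apply _) measurable_const))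

theorem labelMeasure_bool_not_le {δ : ℝ} (hδ0 : 0 ≤ δ) (hδ1 : δ ≤ 1) :
    labelMeasure Bool {x | ¬(x true ≤ δ ∧ x false ≤ δ)} ≤ ENNReal.ofReal (Real.exp (-δ ^ 2)) := by
  have hbox : {x : Bool → ℝ | ¬(x true ≤ δ ∧ x false ≤ δ)} =
      (Set.univ.pi fun _ : Bool => Set.Iic δ)ᶜ := by
    ext x
    simp [and_comm]
  have hvol : volume.restrict (Set.Icc (0 : ℝ) 1) (Set.Iic δ) = ENNReal.ofReal δ := by
    rw [Measure.restrict_apply measurableSet_Iic]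
    have : Set.Iic δ ∩ Set.Icc 0 1 = Set.Icc 0 δ := by
      ext x
      simp only [Set.mem_inter_iff, Set.mem_Iic, Set.mem_Icc]
      exact ⟨fun h => ⟨h.2.1, h.1⟩, fun h => ⟨h.2, h.1, h.2.trans hδ1⟩⟩
    rw [this, Real.volume_Icc, sub_zero]
  rw [hbox, prob_compl_eq_one_sub (MeasurableSet.univ_pi fun _ => measurableSet_Iic), labelMeasure,
    Measure.pi_pi, prod_const, hvol, card_univ, Fintype.card_bool, ← ENNReal.ofReal_pow hδ0,
    ← ENNReal.ofReal_one, ← ENNReal.ofReal_sub _ (by positivity)]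
  exact ENNReal.ofReal_le_ofReal (by linarith [Real.add_one_le_exp (-δ ^ 2)])

theorem labelMeasure_hubless_le {n : ℕ} [NeZero n] {δ : ℝ} (hδ0 : 0 ≤ δ) (hδ1 : δ ≤ 1) :
    (labelMeasure (Sym2 (Fin n))).real (hubless n δ) ≤
      n * Real.exp (-δ ^ 2) ^ (n - 2) := by
  have hv : ∀ v : Fin n, v ≠ 0 → labelMeasure (Sym2 (Fin n))
      {u | ∀ w : {w : Fin n // w ≠ v ∧ w ≠ 0}, ¬(u s(v, w) ≤ δ ∧ u s((w : Fin n), 0) ≤ δ)} ≤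
      ENNReal.ofReal (Real.exp (-δ ^ 2)) ^ (n - 2) := by
    intro v hv
    have hrow := labelMeasure_rows (E := Sym2 (Fin n)) (ι := {w : Fin n // w ≠ v ∧ w ≠ 0})
      (κ := Bool) (φ := fun w b => bif b then s(v, (w : Fin n)) else s((w : Fin n), 0))
      (by
        rintro ⟨⟨w, hw⟩, b⟩ ⟨⟨w', hw'⟩, b'⟩ h
        cases b <;> cases b' <;> simp_all [Function.uncurry])
      (B := fun _ => {x | ¬(x true ≤ δ ∧ x false ≤ δ)})
      (fun _ => MeasurableSet.compl
        ((measurableSet_le (measurable_pi_apply _) measurable_const).inter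
          (measurableSet_le (measurable_pi_apply _) measurable_const)))
    have hcard : Fintype.card {w : Fin n // w ≠ v ∧ w ≠ 0} = n - 2 := by
      have : ({w : Fin n | w ≠ v ∧ w ≠ 0} : Finset (Fin n)) = {v, 0}ᶜ := by
        ext w; simp
      rw [Fintype.card_subtype, this, Finset.card_compl, Fintype.card_fin, Finset.card_pair hv]
    simp only [prod_const, card_univ, hcard] at hrow
    refine le_trans (le_of_eq ?_) (hrow.le.trans
      (pow_le_pow_left' (labelMeasure_bool_not_le hδ0 hδ1) _))
    rfl
  have h : labelMeasure (Sym2 (Fin n)) (hubless n δ) ≤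
      n * ENNReal.ofReal (Real.exp (-δ ^ 2)) ^ (n - 2) := by
    refine (measure_iUnion_fintype_le _ _).trans ?_
    have : (n : ENNReal) * ENNReal.ofReal (Real.exp (-δ ^ 2)) ^ (n - 2) =
        ∑ _v : Fin n, ENNReal.ofReal (Real.exp (-δ ^ 2)) ^ (n - 2) := by simp
    rw [this]
    refine Finset.sum_le_sum fun v _ => ?_
    by_cases h0 : v = 0
    · simp [h0]
    · exact (measure_mono (Set.iUnion_subset fun _ => subset_rfl)).trans (hv v h0)
  refine (ENNReal.toReal_mono (by finiteness) h).trans (le_of_eq ?_)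
  rw [ENNReal.toReal_mul, ENNReal.toReal_pow, ENNReal.toReal_ofReal (Real.exp_pos _).le,
    ENNReal.toReal_natCast]

/-- The labellings under which every edge `{v j, v (j + 1)}` is a shortest one among the edges
joining `v j` to its shifts. -/
def argminCycle {n k : ℕ} [NeZero n] (v : Fin (k + 1) → Fin n) : Set (Sym2 (Fin n) → ℝ) :=
  {u | ∀ j, ∀ a : shifts n, u s(v j, v (j + 1)) ≤ u s(v j, v j + a)}

theorem measurableSet_argminCycle {n k : ℕ} [NeZero n] (v : Fin (k + 1) → Fin n) :
    MeasurableSet (argminCycle v) := by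
  simp only [argminCycle, Set.ofPred_forall]
  exact MeasurableSet.iInter fun j => MeasurableSet.iInter fun a =>
    measurableSet_le (measurable_pi_apply _) (measurable_pi_apply _)

theorem labelMeasure_argminCycle_le {n k : ℕ} [NeZero n] {v : Fin (k + 1) → Fin n}
    (hv : v ∈ shiftCycles n k) :
    (labelMeasure (Sym2 (Fin n))).real (argminCycle v) ≤ ((shifts n).card : ℝ)⁻¹ ^ (k + 1) := by
  obtain ⟨hinj, hstep⟩ := (Finset.mem_filter.1 hv).2
  have hrow := labelMeasure_rows (E := Sym2 (Fin n)) (ι := Fin (k + 1)) (κ := shifts n)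
    (φ := fun j a => s(v j, v j + (a : Fin n)))
    (by
      rintro ⟨i, a⟩ ⟨j, b⟩ h
      obtain ⟨h1, h2⟩ := shift_edge_injective a.2 b.2 h
      exact Prod.ext (hinj h1) (Subtype.ext h2))
    (B := fun j => {x | ∀ a, x ⟨v (j + 1) - v j, hstep j⟩ ≤ x a})
    (fun j => by
      simp only [Set.ofPred_forall]
      exact MeasurableSet.iInter fun a =>
        measurableSet_le (measurable_pi_apply _) (measurable_pi_apply _))
  have hset : argminCycle v = {u | ∀ j, (fun a : shifts n => u s(v j, v j + (a : Fin n))) ∈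
      {x : shifts n → ℝ | ∀ a, x ⟨v (j + 1) - v j, hstep j⟩ ≤ x a}} := by
    ext u
    simp [argminCycle]
  have hle : labelMeasure (Sym2 (Fin n)) (argminCycle v) ≤
      ((shifts n).card : ENNReal)⁻¹ ^ (k + 1) := by
    rw [hset, hrow]
    refine (Finset.prod_le_prod' fun j _ => labelMeasure_argmin_le _).trans ?_
    simp
  have hpos : (shifts n).card ≠ 0 := Finset.card_ne_zero_of_mem (hstep 0)
  refine (ENNReal.toReal_mono (by simp [hpos]) hle).trans (le_of_eq ?_)
  simp

theorem spanningTrees_top_nonempty (n : ℕ) [NeZero n] :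
    (spanningTrees (⊤ : SimpleGraph (Fin n))).Nonempty := by
  classical
  obtain ⟨T, -, hT⟩ := (SimpleGraph.connected_top (V := Fin n)).exists_isTree_le
  refine ⟨T.edgeFinset, Finset.mem_filter.2 ⟨Finset.mem_univ _, ?_, ?_⟩⟩
  · rw [SimpleGraph.coe_edgeFinset]
    exact SimpleGraph.edgeSet_mono le_top
  · rwa [SimpleGraph.coe_edgeFinset, SimpleGraph.fromEdgeSet_edgeSet]

theorem sum_le_of_mem_spanningTrees {n : ℕ} {G : SimpleGraph (Fin n)} {u : Sym2 (Fin n) → ℝ}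
    (hu : ∀ e, u e ≤ 1) {T : Finset (Sym2 (Fin n))} (hT : T ∈ spanningTrees G) :
    ∑ e ∈ T, u e ≤ n := by
  have hcard := card_of_mem_spanningTrees hT
  rw [Fintype.card_fin] at hcard
  refine (Finset.sum_le_card_nsmul _ _ 1 fun e _ => hu e).trans ?_
  simp only [nsmul_eq_mul, mul_one, Nat.cast_le]
  omega

/-- A bound for the minimal length of a spanning tree of `Kₙ` whose expectation is bounded: the
total length of the shortest shifted edges, the cost of joining their cycles to the vertex `0`, and
a correction on the event `hubless n δ`. -/
def treeBound {n : ℕ} [NeZero n] (hn : (shifts n).Nonempty) (δ : ℝ) (u : Sym2 (Fin n) → ℝ) : ℝ :=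
  ∑ i, (shifts n).inf' hn (fun a => u s(i, i + a)) +
    2 * δ * ∑ k ∈ Finset.range n, 1 / ((k : ℝ) + 1) *
      ∑ v ∈ shiftCycles n k, (argminCycle v).indicator 1 u +
    n * (hubless n δ).indicator 1 u

theorem exists_spanningTree_le_treeBound {n : ℕ} [NeZero n] (hn : (shifts n).Nonempty) {δ : ℝ}
    (hδ : 0 ≤ δ) {u : Sym2 (Fin n) → ℝ} (hu : ∀ e, u e ∈ Set.Icc (0 : ℝ) 1) :
    ∃ T ∈ spanningTrees (⊤ : SimpleGraph (Fin n)), ∑ e ∈ T, u e ≤ treeBound hn δ u := by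
  have hmin : 0 ≤ ∑ i, (shifts n).inf' hn (fun a => u s(i, i + a)) :=
    Finset.sum_nonneg fun i _ => (Finset.le_inf'_iff hn _).2 fun a _ => (hu _).1
  have hcyc : ∀ k, 0 ≤ ∑ v ∈ shiftCycles n k,
      (argminCycle v).indicator (1 : (Sym2 (Fin n) → ℝ) → ℝ) u := fun k =>
    Finset.sum_nonneg fun v _ => Set.indicator_nonneg (fun _ _ => zero_le_one) _
  have hcyc' : 0 ≤ 2 * δ * ∑ k ∈ Finset.range n, 1 / ((k : ℝ) + 1) *
      ∑ v ∈ shiftCycles n k, (argminCycle v).indicator 1 u :=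
    mul_nonneg (by positivity)
      (Finset.sum_nonneg fun k _ => mul_nonneg (by positivity) (hcyc k))
  by_cases hub : u ∈ hubless n δ
  · obtain ⟨T, hT⟩ := spanningTrees_top_nonempty n
    refine ⟨T, hT, (sum_le_of_mem_spanningTrees (fun e => (hu e).2) hT).trans ?_⟩
    rw [treeBound, Set.indicator_of_mem hub, Pi.one_apply]
    linarith
  · choose g hg hgmin using fun i => Finset.exists_mem_eq_inf' hn fun a => u s(i, i + a)
    have hub' : ∀ v : Fin n, v ≠ 0 →
        ∃ w, w ≠ v ∧ w ≠ 0 ∧ u s(v, w) ≤ δ ∧ u s(w, 0) ≤ δ := by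
      intro v hv
      by_contra! hcon
      refine hub (Set.mem_iUnion₂.2 ⟨v, hv, ?_⟩)
      rintro ⟨w, hw⟩ ⟨h1, h2⟩
      exact absurd h2 (not_le.2 (hcon w hw.1 hw.2 h1))
    obtain ⟨T, hT, hle⟩ := exists_spanningTree_of_reps (u := u) (fun e => (hu e).1)
      (f := fun i => i + g i) (fun i h => ne_zero_of_mem_shifts (hg i) (add_eq_left.1 h))
      (exists_iterate_mem_cycleReps _) hub'
    refine ⟨T, hT, hle.trans ?_⟩
    rw [treeBound, Set.indicator_of_notMem hub, mul_zero, add_zero]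
    simp only [hgmin]
    gcongr
    refine (card_cycleReps_le _).trans (Finset.sum_le_sum fun k _ => ?_)
    gcongr
    refine (Nat.cast_le.2 (card_minimalPeriod_le (fun i => ?_) k)).trans ?_
    · simpa using hg i
    rw [Finset.card_filter, Nat.cast_sum]
    refine Finset.sum_le_sum fun v _ => ?_
    split_ifs with h
    · rw [Set.indicator_of_mem]
      · simp
      · intro j a
        rw [← h j, ← hgmin]
        exact Finset.inf'_le _ a.2
    · rw [Nat.cast_zero]
      exact Set.indicator_nonneg (fun _ _ => zero_le_one) _

theorem integral_treeBound_le {n : ℕ} [NeZero n] (hn : (shifts n).Nonempty) {δ : ℝ}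
    (hδ0 : 0 ≤ δ) (hδ1 : δ ≤ 1) :
    Integrable (treeBound hn δ) (labelMeasure (Sym2 (Fin n))) ∧
      ∫ u, treeBound hn δ u ∂labelMeasure (Sym2 (Fin n)) ≤
        n / (shifts n).card * (1 + 2 * δ * (1 + Real.log n)) +
          n * (n * Real.exp (-δ ^ 2) ^ (n - 2)) := by
  have hinj : ∀ i : Fin n, Function.Injective fun a => s(i, i + a) := fun i a b h =>
    add_left_cancel (Sym2.congr_right.1 h)
  have hind : ∀ {A : Set (Sym2 (Fin n) → ℝ)}, MeasurableSet A →
      Integrable (A.indicator (1 : (Sym2 (Fin n) → ℝ) → ℝ)) (labelMeasure (Sym2 (Fin n))) :=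
    fun hA => (integrable_const (1 : ℝ)).indicator hA
  have hi1 : Integrable (fun u => ∑ i, (shifts n).inf' hn (fun a => u s(i, i + a)))
      (labelMeasure (Sym2 (Fin n))) :=
    integrable_finsetSum _ fun i _ => (integral_inf'_le hn (hinj i)).2
  have hi2' : ∀ k, Integrable (fun u => ∑ v ∈ shiftCycles n k,
      (argminCycle v).indicator (1 : (Sym2 (Fin n) → ℝ) → ℝ) u) (labelMeasure (Sym2 (Fin n))) :=
    fun k =>
    integrable_finsetSum _ fun v _ => hind (measurableSet_argminCycle v)
  have hi2 : Integrable (fun u => 2 * δ * ∑ k ∈ Finset.range n, 1 / ((k : ℝ) + 1) *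
      ∑ v ∈ shiftCycles n k, (argminCycle v).indicator 1 u) (labelMeasure (Sym2 (Fin n))) :=
    (integrable_finsetSum _ fun k _ => (hi2' k).const_mul _).const_mul _
  have hi3 : Integrable (fun u => n * (hubless n δ).indicator (1 : (Sym2 (Fin n) → ℝ) → ℝ) u)
      (labelMeasure (Sym2 (Fin n))) :=
    (hind (measurableSet_hubless n δ)).const_mul _
  have hi12 : Integrable (fun u => ∑ i, (shifts n).inf' hn (fun a => u s(i, i + a)) +
      2 * δ * ∑ k ∈ Finset.range n, 1 / ((k : ℝ) + 1) *
        ∑ v ∈ shiftCycles n k, (argminCycle v).indicator 1 u) (labelMeasure (Sym2 (Fin n))) :=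
    hi1.add hi2
  refine ⟨hi12.add hi3, ?_⟩
  have hm : (0 : ℝ) < (shifts n).card := by exact_mod_cast Finset.card_pos.2 hn
  simp only [treeBound]
  rw [integral_add hi12 hi3, integral_add hi1 hi2,
    integral_finsetSum _ fun i _ => (integral_inf'_le hn (hinj i)).2, integral_const_mul,
    integral_const_mul, integral_finsetSum _ fun k _ => (hi2' k).const_mul _,
    integral_indicator_one (measurableSet_hubless n δ), mul_add, mul_one]
  refine add_le_add (add_le_add ?_ ?_)
    (mul_le_mul_of_nonneg_left (labelMeasure_hubless_le hδ0 hδ1) n.cast_nonneg)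
  · refine (Finset.sum_le_card_nsmul _ _ _ fun i _ => (integral_inf'_le hn (hinj i)).1).trans ?_
    simp [div_eq_mul_inv]
  · have hk : ∀ k ∈ Finset.range n, ∫ u, 1 / ((k : ℝ) + 1) *
        ∑ v ∈ shiftCycles n k, (argminCycle v).indicator 1 u ∂labelMeasure (Sym2 (Fin n)) ≤
        ((k : ℝ) + 1)⁻¹ * (n / (shifts n).card) := by
      intro k _
      rw [integral_const_mul, one_div,
        integral_finsetSum _ fun v _ => hind (measurableSet_argminCycle v)]
      gcongr
      simp only [integral_indicator_one (measurableSet_argminCycle _)]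
      refine (Finset.sum_le_card_nsmul _ _ _ fun v hv => labelMeasure_argminCycle_le hv).trans ?_
      rw [nsmul_eq_mul]
      have hcard : ((shiftCycles n k).card : ℝ) ≤ n * ((shifts n).card : ℝ) ^ k := by
        exact_mod_cast card_shiftCycles_le n k
      refine (mul_le_mul_of_nonneg_right hcard (by positivity)).trans (le_of_eq ?_)
      rw [inv_pow, pow_succ]
      field_simp
    have hharm := harmonic_le_one_add_log n
    have hsum : ∑ k ∈ Finset.range n, ((k : ℝ) + 1)⁻¹ = (harmonic n : ℝ) := by
      simp [harmonic]
    refine (mul_le_mul_of_nonneg_left (Finset.sum_le_sum hk) (by positivity)).trans ?_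
    rw [← Finset.sum_mul, hsum, ← mul_assoc]
    refine (mul_le_mul_of_nonneg_right
      (mul_le_mul_of_nonneg_left hharm (by positivity)) (by positivity)).trans (le_of_eq ?_)
    ring

/-- The mean length of the weighted spanning tree of `Kₙ` given the labels `u`. -/
def meanLength (n : ℕ) (β : ℝ) (u : Sym2 (Fin n) → ℝ) : ℝ :=
  (∑ T ∈ spanningTrees (⊤ : SimpleGraph (Fin n)),
      treeWeight (fun e => Real.exp (-β * u e)) T * (∑ e ∈ T, u e)) /
    partZ (⊤ : SimpleGraph (Fin n)) (fun e => Real.exp (-β * u e))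

theorem meanLength_nonneg {n : ℕ} {β : ℝ} {u : Sym2 (Fin n) → ℝ} (hu : ∀ e, 0 ≤ u e) :
    0 ≤ meanLength n β u := by
  unfold meanLength partZ
  simp only [treeWeight_exp]
  exact div_nonneg (Finset.sum_nonneg fun T _ => mul_nonneg (Real.exp_pos _).le
    (Finset.sum_nonneg fun e _ => hu e)) (by positivity)

theorem meanLength_le {n : ℕ} {β : ℝ} {u : Sym2 (Fin n) → ℝ} (hu : ∀ e, u e ≤ 1) :
    meanLength n β u ≤ n := by
  unfold meanLength partZ
  simp only [treeWeight_exp]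
  refine div_le_of_le_mul₀ (by positivity) (by positivity) ?_
  rw [Finset.mul_sum]
  refine Finset.sum_le_sum fun T hT => ?_
  rw [mul_comm]
  exact mul_le_mul_of_nonneg_right (sum_le_of_mem_spanningTrees hu hT) (Real.exp_pos _).le

theorem meanLength_le_of_mem_spanningTrees {n : ℕ} [NeZero n] {β : ℝ} (hβ : 0 < β)
    {u : Sym2 (Fin n) → ℝ} {T : Finset (Sym2 (Fin n))}
    (hT : T ∈ spanningTrees (⊤ : SimpleGraph (Fin n))) :
    meanLength n β u ≤ ∑ e ∈ T, u e + (2 * n * Real.log n + 1) / β := by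
  unfold meanLength partZ
  simp only [treeWeight_exp]
  refine (gibbs_mean_le (fun T => ∑ e ∈ T, u e) hT hβ).trans ?_
  gcongr
  have h : Real.log (spanningTrees (⊤ : SimpleGraph (Fin n))).card ≤
      Real.log ((n : ℝ) ^ (2 * n)) :=
    Real.log_le_log (by exact_mod_cast Finset.card_pos.2 ⟨T, hT⟩)
      (by exact_mod_cast card_spanningTrees_le (NeZero.one_le))
  rwa [Real.log_pow, Nat.cast_mul, Nat.cast_ofNat] at h

theorem expLengthK_nonneg (n : ℕ) (β : ℝ) : 0 ≤ expLengthK n β := by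
  refine integral_nonneg_of_ae ?_
  filter_upwards [labelMeasure_ae_mem_Icc (Sym2 (Fin n))] with u hu
  exact meanLength_nonneg fun e => (hu e).1

theorem expLengthK_le (n : ℕ) (β : ℝ) : expLengthK n β ≤ n := by
  have h : expLengthK n β ≤ ∫ _, (n : ℝ) ∂labelMeasure (Sym2 (Fin n)) := by
    refine integral_mono_of_nonneg ?_ (integrable_const _) ?_
    · filter_upwards [labelMeasure_ae_mem_Icc (Sym2 (Fin n))] with u hu
      exact meanLength_nonneg fun e => (hu e).1
    · filter_upwards [labelMeasure_ae_mem_Icc (Sym2 (Fin n))] with u hu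
      exact meanLength_le fun e => (hu e).2
  simpa using h

theorem expLengthK_le_add {n : ℕ} [NeZero n] (hn : (shifts n).Nonempty) {δ : ℝ}
    (hδ0 : 0 ≤ δ) (hδ1 : δ ≤ 1) {β : ℝ} (hβ : 0 < β) :
    expLengthK n β ≤ n / (shifts n).card * (1 + 2 * δ * (1 + Real.log n)) +
      n * (n * Real.exp (-δ ^ 2) ^ (n - 2)) + (2 * n * Real.log n + 1) / β := by
  obtain ⟨hint, hle⟩ := integral_treeBound_le hn hδ0 hδ1
  have h : expLengthK n β ≤ ∫ u, treeBound hn δ u + (2 * n * Real.log n + 1) / β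
      ∂labelMeasure (Sym2 (Fin n)) := by
    refine integral_mono_of_nonneg ?_ (hint.add (integrable_const _)) ?_
    · filter_upwards [labelMeasure_ae_mem_Icc (Sym2 (Fin n))] with u hu
      exact meanLength_nonneg fun e => (hu e).1
    · filter_upwards [labelMeasure_ae_mem_Icc (Sym2 (Fin n))] with u hu
      obtain ⟨T, hT, hTle⟩ := exists_spanningTree_le_treeBound hn hδ0 hu
      exact (meanLength_le_of_mem_spanningTrees hβ hT).trans (by gcongr)
  rw [integral_add hint (integrable_const _), integral_const, probReal_univ, one_smul] at h
  linarith

theorem eventually_sq_mul_exp_le_one : ∀ᶠ n : ℕ in atTop,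
    (n : ℝ) * (n * Real.exp (-(1 / (1 + Real.log n)) ^ 2) ^ (n - 2)) ≤ 1 := by
  have hlog : Tendsto (fun n : ℕ => Real.log n) atTop atTop :=
    Real.tendsto_log_atTop.comp tendsto_natCast_atTop_atTop
  have ho := ((Real.isLittleO_pow_log_id_atTop (n := 3)).comp_tendsto
    tendsto_natCast_atTop_atTop).bound (c := 1 / 16) (by norm_num)
  filter_upwards [ho, hlog.eventually_ge_atTop 1, eventually_ge_atTop 4] with n hn hl h4
  have h4' : (4 : ℝ) ≤ n := by exact_mod_cast h4
  set x := Real.log n with hx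
  have hn0 : (0 : ℝ) < n := by linarith
  have hx3 : 16 * x ^ 3 ≤ n := by
    simp only [Function.comp_apply, id_eq, ← hx, Real.norm_eq_abs, abs_of_pos hn0,
      abs_of_nonneg (pow_nonneg (zero_le_one.trans hl) 3)] at hn
    linarith
  have hexp : (n : ℝ) = Real.exp x := (Real.exp_log hn0).symm
  have hsub : ((n - 2 : ℕ) : ℝ) = n - 2 := by
    rw [Nat.cast_sub (by omega), Nat.cast_ofNat]
  have hkey : 2 * x ≤ (n - 2) * (1 / (1 + x)) ^ 2 := by
    rw [one_div, inv_pow, ← div_eq_mul_inv, le_div_iff₀ (by positivity)]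
    nlinarith [mul_nonneg (sub_nonneg.2 hl) (sub_nonneg.2 hl),
      mul_nonneg (mul_nonneg (sub_nonneg.2 hl) (sub_nonneg.2 hl)) (zero_le_one.trans hl),
      sq_nonneg x]
  rw [← Real.exp_nat_mul, hsub]
  calc (n : ℝ) * (n * Real.exp ((n - 2) * -(1 / (1 + x)) ^ 2))
      = Real.exp (x + (x + (n - 2) * -(1 / (1 + x)) ^ 2)) := by
        rw [Real.exp_add, Real.exp_add, ← hexp]
    _ ≤ 1 := Real.exp_le_one_iff.2 (by linarith)

theorem eventually_expLengthK_le : ∀ᶠ n : ℕ in atTop, ∀ β : ℝ, 0 < β →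
    expLengthK n β ≤ 13 + (2 * n * Real.log n + 1) / β := by
  filter_upwards [eventually_sq_mul_exp_le_one, eventually_ge_atTop 3] with n hn h3 β hβ
  have : NeZero n := ⟨by omega⟩
  have hcard := card_shifts n
  have hs : (shifts n).Nonempty := Finset.card_pos.1 (by omega)
  have hl : 0 ≤ Real.log n := Real.log_natCast_nonneg n
  have hratio : (n : ℝ) / (shifts n).card ≤ 4 := by
    rw [div_le_iff₀ (by exact_mod_cast Finset.card_pos.2 hs)]
    exact_mod_cast (by omega : n ≤ 4 * (shifts n).card)
  have hδ1 : 1 / (1 + Real.log n) ≤ 1 := by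
    rw [div_le_one (by linarith)]
    linarith
  have h := expLengthK_le_add hs (by positivity) hδ1 hβ
  have h1 : 2 * (1 / (1 + Real.log n)) * (1 + Real.log n) = 2 := by
    field_simp
  rw [h1] at h
  linarith

/-- If `βₙ = O(n·log n)`, then
`E[L(WST^{βₙ}(Kₙ))] = O(n·log n / (βₙ + log n))`. -/
theorem expected_length_intermediate (β : ℕ → ℝ)
    (hβ0 : ∀ n, 0 ≤ β n)
    (hβ : β =O[atTop] fun n : ℕ => (n : ℝ) * Real.log n) :
    (fun n : ℕ => expLengthK n (β n))
      =O[atTop] fun n : ℕ => (n : ℝ) * Real.log n / (β n + Real.log n) := by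
  obtain ⟨A, hA, hβA⟩ := hβ.exists_pos
  have hlog : Tendsto (fun n : ℕ => Real.log n) atTop atTop :=
    Real.tendsto_log_atTop.comp tendsto_natCast_atTop_atTop
  refine Asymptotics.IsBigO.of_bound (2 * (13 * A + 3)) ?_
  filter_upwards [hβA.bound, hlog.eventually_ge_atTop 1, eventually_ge_atTop 1,
    eventually_expLengthK_le] with n hn hl h1 hle
  have h1' : (1 : ℝ) ≤ n := by exact_mod_cast h1
  have hnl : 1 ≤ n * Real.log n := one_le_mul_of_one_le_of_one_le h1' hl
  have hb := hβ0 n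
  rw [Real.norm_of_nonneg hb, Real.norm_of_nonneg (by positivity)] at hn
  rw [Real.norm_of_nonneg (expLengthK_nonneg _ _), Real.norm_of_nonneg (by positivity),
    ← mul_div_assoc, le_div_iff₀ (by linarith)]
  rcases le_total (β n) (Real.log n) with hcase | hcase
  · calc expLengthK n (β n) * (β n + Real.log n) ≤ n * (2 * Real.log n) :=
        mul_le_mul (expLengthK_le _ _) (by linarith) (by linarith) (by positivity)
      _ ≤ 2 * (13 * A + 3) * (n * Real.log n) := by nlinarith
  · have hpos : 0 < β n := by linarith
    calc expLengthK n (β n) * (β n + Real.log n)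
        ≤ (13 + (2 * n * Real.log n + 1) / β n) * (2 * β n) :=
          mul_le_mul (hle _ hpos) (by linarith) (by linarith) (by positivity)
      _ = 2 * (13 * β n + 2 * (n * Real.log n) + 1) := by field_simp; ring
      _ ≤ 2 * (13 * A + 3) * (n * Real.log n) := by nlinarith

end WSTPaper
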